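/- arXiv:1910.09979 — 5 statements merged into one kernel-verified Lean document; each statement's English description precedes it below -/
import Mathlib

section
/- Let U ∈ ℝ^{m×r} be an orthogonal nonnegative matrix and set K = UUᵀ. Then the entrywise ℓ¹ norm of K is at most m, i.e., Σ_{i=1}^m Σ_{j=1}^m |k_{ij}| ≤ m, where m is the number of rows of U. -/
open Matrix

/-- Bessel's inequality for a real matrix with orthonormal columns. -/
theorem Matrix.vecMul_dotProduct_self_le_of_transpose_mul_eq_one {m n : Type*} [Fintype m]
    [Fintype n] [DecidableEq n] {U : Matrix m n ℝ} (horth : Uᵀ * U = 1) (v : m → ℝ) :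
    (v ᵥ* U) ⬝ᵥ (v ᵥ* U) ≤ v ⬝ᵥ v := by
  set s := v ᵥ* U with hs
  have hcross : v ⬝ᵥ (U *ᵥ s) = s ⬝ᵥ s := dotProduct_mulVec v U s
  have hproj : (U *ᵥ s) ⬝ᵥ (U *ᵥ s) = s ⬝ᵥ s := by
    rw [dotProduct_mulVec, ← mulVec_transpose, mulVec_mulVec, horth, one_mulVec]
  have hnonneg : 0 ≤ (v - U *ᵥ s) ⬝ᵥ (v - U *ᵥ s) :=
    Finset.sum_nonneg fun i _ => mul_self_nonneg _
  rw [sub_dotProduct, dotProduct_sub, dotProduct_sub, dotProduct_comm (U *ᵥ s) v, hcross,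
    hproj] at hnonneg
  linarith

/-- If `U ∈ ℝ^{m×r}` is an orthogonal nonnegative matrix and `K = U * Uᵀ`, then the
entrywise ℓ¹ norm of `K` is at most `m`, the number of rows of `U`. -/
theorem orthogonal_nonneg_gram_entrywise_l1_le (m r : ℕ) (hm : 0 < m) (hr : 0 < r)
    (U : Matrix (Fin m) (Fin r) ℝ)
    (hnonneg : ∀ i j, 0 ≤ U i j)
    (horth : Uᵀ * U = 1) :
    ∑ i : Fin m, ∑ j : Fin m, |(U * Uᵀ) i j| ≤ (m : ℝ) := by
  have hK (i j : Fin m) : 0 ≤ (U * Uᵀ) i j := by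
    rw [mul_apply]
    exact Finset.sum_nonneg fun k _ => mul_nonneg (hnonneg i k) (hnonneg j k)
  calc ∑ i : Fin m, ∑ j : Fin m, |(U * Uᵀ) i j|
      = 1 ⬝ᵥ ((U * Uᵀ) *ᵥ 1) := by
        simp [dotProduct, mulVec, abs_of_nonneg (hK _ _)]
    _ = (1 ᵥ* U) ⬝ᵥ (1 ᵥ* U) := by
        rw [← mulVec_mulVec, dotProduct_mulVec, mulVec_transpose]
    _ ≤ 1 ⬝ᵥ 1 := vecMul_dotProduct_self_le_of_transpose_mul_eq_one horth 1
    _ = m := by simp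
end

section
/- Let A ∈ ℝ^{I₁×⋯×I_d} admit a nonnegative orthogonal Tucker decomposition with core S ∈ ℝ^{J₁×⋯×J_d} and factors U^(1),…,U^(d). Fix a mode n ∈ {1,…,d}, a column index j ∈ {1,…,Jₙ}, and two row indices t₁, t₂ ∈ {1,…,Iₙ} such that u^(n)_{t₁,j} ≠ 0 and u^(n)_{t₂,j} ≠ 0 (t₁ and t₂ belong to the same class in mode n). Then for every choice of the remaining indices i_m ∈ {1,…,I_m} (m ≠ n), a_{i₁,…,i_{n−1},t₁,i_{n+1},…,i_d} · u^(n)_{t₂,j} = a_{i₁,…,i_{n−1},t₂,i_{n+1},…,i_d} · u^(n)_{t₁,j}; that is, rows t₁ and t₂ of the mode-n unfolding of A are proportional. -/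
open Matrix

/-- A row of a nonnegative matrix with orthonormal columns has at most one nonzero entry. -/
theorem Matrix.eq_zero_of_nonneg_of_transpose_mul_self_eq_one
    {ι κ : Type*} [Fintype ι] [DecidableEq κ] {U : Matrix ι κ ℝ}
    (hU : ∀ i j, 0 ≤ U i j) (horth : Uᵀ * U = 1) {t : ι} {j k : κ}
    (ht : U t j ≠ 0) (hk : k ≠ j) : U t k = 0 := by
  have h : ∑ i, U i k * U i j = 0 := by
    simpa [Matrix.mul_apply, Matrix.one_apply_ne hk] using congrFun (congrFun horth k) j
  have h' := (Finset.sum_eq_zero_iff_of_nonneg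
    fun i _ => mul_nonneg (hU i k) (hU i j)).1 h t (Finset.mem_univ t)
  exact (mul_eq_zero.1 h').resolve_right ht

/-- Rows of the mode-`n` unfolding of a nonnegative orthogonal Tucker tensor that belong
to the same class (i.e. whose rows of `U^(n)` have their nonzero entry in the same
column `j`) are proportional. -/
theorem tucker_same_class_rows_proportional
    (d : ℕ) (I J : Fin d → ℕ)
    (A : (∀ n : Fin d, Fin (I n)) → ℝ)
    (S : (∀ n : Fin d, Fin (J n)) → ℝ)
    (U : ∀ n : Fin d, Matrix (Fin (I n)) (Fin (J n)) ℝ)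
    (hSnonneg : ∀ jdx, 0 ≤ S jdx)
    (hUnonneg : ∀ n i j, 0 ≤ U n i j)
    (horth : ∀ n, (U n)ᵀ * U n = 1)
    (hA : ∀ idx : ∀ n : Fin d, Fin (I n),
      A idx = ∑ jdx : ∀ n : Fin d, Fin (J n), S jdx * ∏ n, U n (idx n) (jdx n))
    (n : Fin d) (j : Fin (J n)) (t₁ t₂ : Fin (I n))
    (ht₁ : U n t₁ j ≠ 0) (ht₂ : U n t₂ j ≠ 0) :
    ∀ idx : ∀ m : Fin d, Fin (I m),
      A (Function.update idx n t₁) * U n t₂ j = A (Function.update idx n t₂) * U n t₁ j := by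
  intro idx
  have hsplit (t : Fin (I n)) (jdx : ∀ m : Fin d, Fin (J m)) :
      ∏ m, U m (Function.update idx n t m) (jdx m) =
        U n t (jdx n) * ∏ m ∈ Finset.univ.erase n, U m (idx m) (jdx m) := by
    rw [← Finset.mul_prod_erase Finset.univ _ (Finset.mem_univ n), Function.update_self]
    congr 1
    refine Finset.prod_congr rfl fun m hm => ?_
    rw [Function.update_of_ne (Finset.ne_of_mem_erase hm)]
  rw [hA, hA, Finset.sum_mul, Finset.sum_mul]
  refine Finset.sum_congr rfl fun jdx _ => ?_
  rw [hsplit, hsplit]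
  by_cases hj : jdx n = j
  · rw [hj]
    ring
  · rw [eq_zero_of_nonneg_of_transpose_mul_self_eq_one (hUnonneg n) (horth n) ht₁ hj,
      eq_zero_of_nonneg_of_transpose_mul_self_eq_one (hUnonneg n) (horth n) ht₂ hj]
    ring
end

section
/- Let A ∈ ℝ^{I₁×⋯×I_d} admit a nonnegative orthogonal Tucker decomposition with core S ∈ ℝ^{J₁×⋯×J_d} and factors U^(1),…,U^(d). Fix a mode n and a column j ∈ {1,…,Jₙ}, and let T_j = {t ∈ {1,…,Iₙ} : u^(n)_{t,j} ≠ 0}. Then Σ over all multi-indices (i₁,…,i_d) with i_n ∈ T_j of a_{i₁…i_d}² equals Σ over all multi-indices (j₁,…,j_d) with j_n = j of s_{j₁…j_d}²; that is, the squared Frobenius norm of the rows of the mode-n unfolding of A belonging to class j equals the squared Frobenius norm of the j-th row of the mode-n unfolding of S. -/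
open Matrix
open scoped Classical

/-- Columns of a matrix with orthonormal columns and nonnegative entries have disjoint supports. -/
theorem Matrix.mul_eq_zero_of_nonneg_of_transpose_mul_self_eq_one
    {m n : Type*} [Fintype m] [DecidableEq n] {U : Matrix m n ℝ}
    (hU : ∀ i j, 0 ≤ U i j) (horth : Uᵀ * U = 1) (i : m) {j k : n} (hjk : j ≠ k) :
    U i j * U i k = 0 := by
  have h := congrFun (congrFun horth j) k
  simp only [Matrix.mul_apply, Matrix.transpose_apply, Matrix.one_apply_ne hjk] at h
  exact (Finset.sum_eq_zero_iff_of_nonneg fun t _ => mul_nonneg (hU t j) (hU t k)).1 h i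
    (Finset.mem_univ i)

/-- Multiplying a core tensor by factors with orthonormal columns preserves the Frobenius norm. -/
theorem sum_sq_tucker_eq_sum_sq_core {ι : Type*} [Fintype ι] [DecidableEq ι]
    {α β : ι → Type*} [∀ n, Fintype (α n)] [∀ n, Fintype (β n)] [∀ n, DecidableEq (β n)]
    (S : (∀ n, β n) → ℝ) (U : ∀ n, Matrix (α n) (β n) ℝ) (horth : ∀ n, (U n)ᵀ * U n = 1) :
    ∑ x : ∀ n, α n, (∑ y : ∀ n, β n, S y * ∏ n, U n (x n) (y n)) ^ 2 = ∑ y, S y ^ 2 := by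
  have hprod (y z : ∀ n, β n) :
      ∑ x : ∀ n, α n, (∏ n, U n (x n) (y n)) * ∏ n, U n (x n) (z n) =
        if y = z then 1 else 0 := by
    have hcol (n : ι) : ∑ i, U n i (y n) * U n i (z n) = if y n = z n then 1 else 0 := by
      have h := congrFun (congrFun (horth n) (y n)) (z n)
      rwa [Matrix.mul_apply, Matrix.one_apply] at h
    simp_rw [← Finset.prod_mul_distrib]
    rw [← Fintype.prod_sum fun n i => U n i (y n) * U n i (z n)]
    simp_rw [hcol, Finset.prod_ite_zero, funext_iff]
    simp
  calc
    _ = ∑ y, ∑ z, S y * S z *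
        ∑ x : ∀ n, α n, (∏ n, U n (x n) (y n)) * ∏ n, U n (x n) (z n) := by
      simp_rw [sq, Finset.sum_mul_sum, Finset.mul_sum]
      rw [Finset.sum_comm]
      refine Finset.sum_congr rfl fun y _ => ?_
      rw [Finset.sum_comm]
      exact Finset.sum_congr rfl fun z _ => Finset.sum_congr rfl fun x _ => by ring
    _ = ∑ y, S y ^ 2 := by simp [hprod, sq]

/-- For a nonnegative orthogonal Tucker tensor, the squared Frobenius norm of the rows of
the mode-`n` unfolding of `A` belonging to class `j` equals the squared Frobenius norm of
the `j`-th row of the mode-`n` unfolding of the core `S`. -/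
theorem tucker_class_rows_frobenius
    (d : ℕ) (I J : Fin d → ℕ)
    (A : (∀ n : Fin d, Fin (I n)) → ℝ)
    (S : (∀ n : Fin d, Fin (J n)) → ℝ)
    (U : ∀ n : Fin d, Matrix (Fin (I n)) (Fin (J n)) ℝ)
    (hSnonneg : ∀ jdx, 0 ≤ S jdx)
    (hUnonneg : ∀ n i j, 0 ≤ U n i j)
    (horth : ∀ n, (U n)ᵀ * U n = 1)
    (hA : ∀ idx : ∀ n : Fin d, Fin (I n),
      A idx = ∑ jdx : ∀ n : Fin d, Fin (J n), S jdx * ∏ n, U n (idx n) (jdx n))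
    (n : Fin d) (j : Fin (J n)) :
    ∑ idx ∈ Finset.univ.filter (fun idx : ∀ m : Fin d, Fin (I m) => U n (idx n) j ≠ 0),
        (A idx) ^ 2
      = ∑ jdx ∈ Finset.univ.filter (fun jdx : ∀ m : Fin d, Fin (J m) => jdx n = j),
        (S jdx) ^ 2 := by
  have hcore := sum_sq_tucker_eq_sum_sq_core (fun y => if y n = j then S y else 0) U horth
  simp only [ite_pow, ne_eq, OfNat.ofNat_ne_zero, not_false_eq_true, zero_pow] at hcore
  rw [Finset.sum_filter, Finset.sum_filter, ← hcore]
  refine Finset.sum_congr rfl fun x _ => ?_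
  split_ifs with hx
  · rw [hA]
    congr 1
    refine Finset.sum_congr rfl fun y _ => ?_
    split_ifs with hy
    · rfl
    · have hzero : U n (x n) (y n) = 0 :=
        (mul_eq_zero.1 (Matrix.mul_eq_zero_of_nonneg_of_transpose_mul_self_eq_one
          (hUnonneg n) (horth n) (x n) hy)).resolve_right hx
      rw [Finset.prod_eq_zero (Finset.mem_univ n) hzero, mul_zero, zero_mul]
  · rw [Finset.sum_eq_zero, zero_pow two_ne_zero]
    intro y _
    split_ifs with hy
    · rw [Finset.prod_eq_zero (Finset.mem_univ n) (by rw [hy]; exact not_not.1 hx), mul_zero]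
    · exact zero_mul _
end

section
/- Consider the convex problem (P) and its ADMM iteration described in the context, with parameters θ > 0 and λ₁, λ₂, λ₃ > 0. Assume the Lagrangian L admits a saddle point (K*, M*, X*, Z*, b₁*, b₂*, b₃*). Then from any initial point, the ADMM iterates (Kⁱ, Mⁱ, Xⁱ, Zⁱ, b₁ⁱ, b₂ⁱ, b₃ⁱ) converge to a limit (K̃, M̃, X̃, Z̃, b̃₁, b̃₂, b̃₃) satisfying K̃ = M̃ = X̃ = Z̃, and K̃ is an optimal solution of (P), i.e., f(K̃) + h(M̃) + g(X̃) + δ(Z̃) = f(K*) + h(M*) + g(X*) + δ(Z*). -/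
open Matrix
open scoped Classical

/-- Squared Frobenius norm. -/
noncomputable def frobSq {n m : ℕ} (X : Matrix (Fin n) (Fin m) ℝ) : ℝ :=
  ∑ i, ∑ j, X i j ^ 2

/-- Matrix inner product `⟨A, B⟩ = tr(AᵀB)`. -/
noncomputable def mInner {n : ℕ} (X Y : Matrix (Fin n) (Fin n) ℝ) : ℝ :=
  (Xᵀ * Y).trace

/-- `f(K) = ½‖A − KA‖²_F` if `tr K = J`, `+∞` otherwise. -/
noncomputable def fObj {n p : ℕ} (A : Matrix (Fin n) (Fin p) ℝ) (J : ℕ)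
    (K : Matrix (Fin n) (Fin n) ℝ) : EReal :=
  if K.trace = (J : ℝ) then ((1 / 2 * frobSq (A - K * A) : ℝ) : EReal) else ⊤

/-- `g(X) = θ Σ|X_{ij}|`. -/
noncomputable def gObj {n : ℕ} (θ : ℝ) (X : Matrix (Fin n) (Fin n) ℝ) : EReal :=
  ((θ * ∑ i, ∑ j, |X i j| : ℝ) : EReal)

/-- `h(M) = 0` if `M` is symmetric with `0 ⪯ M ⪯ I`, `+∞` otherwise. -/
noncomputable def hObj {n : ℕ} (M : Matrix (Fin n) (Fin n) ℝ) : EReal :=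
  if M = Mᵀ ∧ M.PosSemidef ∧ ((1 : Matrix (Fin n) (Fin n) ℝ) - M).PosSemidef then 0 else ⊤

/-- `δ(Z) = 0` if `Z` is entrywise nonnegative, `+∞` otherwise. -/
noncomputable def dObj {n : ℕ} (Z : Matrix (Fin n) (Fin n) ℝ) : EReal :=
  if ∀ i j, 0 ≤ Z i j then 0 else ⊤

/-- The (augmented) Lagrangian of the splitting formulation. -/
noncomputable def Lag {n p : ℕ} (A : Matrix (Fin n) (Fin p) ℝ) (J : ℕ)
    (θ lam1 lam2 lam3 : ℝ)
    (K M X Z b1 b2 b3 : Matrix (Fin n) (Fin n) ℝ) : EReal :=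
  fObj A J K + hObj M + gObj θ X + dObj Z
    + ((lam1 * (1 / 2 * frobSq (K - M) + mInner (K - M) b1) : ℝ) : EReal)
    + ((lam2 * (1 / 2 * frobSq (K - X) + mInner (K - X) b2) : ℝ) : EReal)
    + ((lam3 * (1 / 2 * frobSq (K - Z) + mInner (K - Z) b3) : ℝ) : EReal)

/-- A saddle point of the Lagrangian. -/
def IsSaddle {n p : ℕ} (A : Matrix (Fin n) (Fin p) ℝ) (J : ℕ) (θ lam1 lam2 lam3 : ℝ)
    (Ks Ms Xs Zs b1s b2s b3s : Matrix (Fin n) (Fin n) ℝ) : Prop :=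
  (∀ b1 b2 b3, Lag A J θ lam1 lam2 lam3 Ks Ms Xs Zs b1 b2 b3
      ≤ Lag A J θ lam1 lam2 lam3 Ks Ms Xs Zs b1s b2s b3s) ∧
  (∀ K M X Z, Lag A J θ lam1 lam2 lam3 Ks Ms Xs Zs b1s b2s b3s
      ≤ Lag A J θ lam1 lam2 lam3 K M X Z b1s b2s b3s)

section Abstract

open Filter Topology
open scoped RealInnerProductSpace

variable {E : Type*} [NormedAddCommGroup E] [InnerProductSpace ℝ E]

/-- A number `a` with `0 ≤ t * a + t ^ 2 * r` for all `t ∈ (0, 1]` is nonnegative. -/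
lemma nonneg_of_forall_mul_add_sq_mul_nonneg {a r : ℝ}
    (h : ∀ t : ℝ, 0 < t → t ≤ 1 → 0 ≤ t * a + t ^ 2 * r) : 0 ≤ a := by
  have hlim : Tendsto (fun t : ℝ => a + t * r) (𝓝[>] 0) (𝓝 (a + 0 * r)) :=
    ((continuous_const.add (continuous_id.mul continuous_const)).tendsto 0).mono_left
      nhdsWithin_le_nhds
  rw [zero_mul, add_zero] at hlim
  refine ge_of_tendsto hlim ?_
  filter_upwards [Ioc_mem_nhdsGT (zero_lt_one' ℝ)] with t ht
  have h' := h t ht.1 ht.2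
  rw [show t * a + t ^ 2 * r = t * (a + t * r) by ring] at h'
  exact nonneg_of_mul_nonneg_right h' ht.1

/-- First-order optimality condition for a convex function plus a sum of weighted squared
distances. -/
lemma ConvexOn.variational_of_isMin_add_sum_sq {ι : Type*} [Fintype ι] {S : Set E} {F : E → ℝ}
    (hF : ConvexOn ℝ S F) (lam : ι → ℝ) (d : ι → E) {x : E} (hx : x ∈ S)
    (hmin : ∀ w ∈ S, F x + ∑ j, lam j / 2 * ‖x + d j‖ ^ 2 ≤ F w + ∑ j, lam j / 2 * ‖w + d j‖ ^ 2)
    {w : E} (hw : w ∈ S) : 0 ≤ F w - F x + ∑ j, lam j * ⟪x + d j, w - x⟫ := by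
  refine nonneg_of_forall_mul_add_sq_mul_nonneg (r := ∑ j, lam j / 2 * ‖w - x‖ ^ 2) ?_
  intro t ht ht1
  have hconv := hF.2 hx hw (sub_nonneg.2 ht1) ht.le (sub_add_cancel 1 t)
  have hmem := hF.1 hx hw (sub_nonneg.2 ht1) ht.le (sub_add_cancel 1 t)
  have hm := hmin _ hmem
  have hsum : ∑ j, lam j / 2 * ‖(1 - t) • x + t • w + d j‖ ^ 2
      = ∑ j, lam j / 2 * ‖x + d j‖ ^ 2 + t * ∑ j, lam j * ⟪x + d j, w - x⟫
        + t ^ 2 * ∑ j, lam j / 2 * ‖w - x‖ ^ 2 := by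
    rw [Finset.mul_sum, Finset.mul_sum, ← Finset.sum_add_distrib, ← Finset.sum_add_distrib]
    refine Finset.sum_congr rfl fun j _ => ?_
    rw [show (1 - t) • x + t • w + d j = (x + d j) + t • (w - x) by module,
      norm_add_sq_real, inner_smul_right, norm_smul, mul_pow, Real.norm_eq_abs, sq_abs]
    ring
  rw [hsum] at hm
  simp only [smul_eq_mul] at hconv
  linarith

/-- The optimality conditions characterising a primal-dual solution `(x, c)` of the problem of
minimizing `F x + ∑ j, G j x` over `x ∈ S ∩ ⋂ j, C j`. -/
structure IsPrimalDual {ι : Type*} [Fintype ι] (lam : ι → ℝ) (S : Set E) (F : E → ℝ)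
    (C : ι → Set E) (G : ι → E → ℝ) (x : E) (c : ι → E) : Prop where
  mem : x ∈ S
  mem_constraint : ∀ j, x ∈ C j
  variational : ∀ w ∈ S, 0 ≤ F w - F x + ∑ j, lam j * ⟪c j, w - x⟫
  subgradient : ∀ j, ∀ w ∈ C j, lam j * ⟪c j, w - x⟫ ≤ G j w - G j x

lemma IsPrimalDual.objective_le {ι : Type*} [Fintype ι] {lam : ι → ℝ} {S : Set E} {F : E → ℝ}
    {C : ι → Set E} {G : ι → E → ℝ} {x w : E} {c d : ι → E}
    (hx : IsPrimalDual lam S F C G x c) (hw : IsPrimalDual lam S F C G w d) :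
    F x + ∑ j, G j x ≤ F w + ∑ j, G j w := by
  have h1 := hx.variational w hw.mem
  have h2 := Finset.sum_le_sum fun j (_ : j ∈ Finset.univ) =>
    hx.subgradient j w (hw.mem_constraint j)
  rw [Finset.sum_sub_distrib] at h2
  linarith

lemma sq_norm_descent {p q r s : E} (hpq : 0 ≤ ⟪p, q⟫) (hrs : 0 ≤ ⟪r, s⟫) :
    ‖p‖ ^ 2 + ‖q‖ ^ 2 + (‖r‖ ^ 2 + ‖s‖ ^ 2) + 2 * ⟪p + s, -(r + q)⟫
      ≤ ‖p - r‖ ^ 2 + ‖q - s‖ ^ 2 := by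
  rw [norm_sub_sq_real, norm_sub_sq_real, inner_neg_right, inner_add_left, inner_add_right,
    inner_add_right]
  rw [real_inner_comm s r] at hrs
  rw [real_inner_comm s q]
  linarith

/-- One step of ADMM decreases the weighted distance to any primal-dual solution. -/
lemma IsPrimalDual.admm_step {ι : Type*} [Fintype ι] {lam : ι → ℝ} (hlam : ∀ j, 0 < lam j)
    {S : Set E} {F : E → ℝ} {C : ι → Set E} {G : ι → E → ℝ} {x : E} {c : ι → E}
    (hx : IsPrimalDual lam S F C G x c) {k : E} {y b y' b' : ι → E}
    (hkS : k ∈ S) (hk : ∀ w ∈ S, 0 ≤ F w - F k + ∑ j, lam j * ⟪k - y j + b j, w - k⟫)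
    (hyC : ∀ j, y' j ∈ C j)
    (hy : ∀ j, ∀ w ∈ C j, lam j * ⟪b' j, w - y' j⟫ ≤ G j w - G j (y' j))
    (hb : ∀ j, b' j = b j + k - y' j)
    (hmono : ∀ j, 0 ≤ ⟪b' j - b j, y' j - y j⟫) :
    ∑ j, lam j * (‖b' j - c j‖ ^ 2 + ‖y' j - x‖ ^ 2)
        + ∑ j, lam j * (‖b' j - b j‖ ^ 2 + ‖y' j - y j‖ ^ 2)
      ≤ ∑ j, lam j * (‖b j - c j‖ ^ 2 + ‖y j - x‖ ^ 2) := by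
  have hsum : 0 ≤ ∑ j, lam j * ⟪k - y j + b j - c j, x - k⟫ := by
    have h1 := hk x hx.mem
    have h2 := hx.variational k hkS
    have h3 : ∑ j, lam j * ⟪k - y j + b j - c j, x - k⟫
        = ∑ j, lam j * ⟪k - y j + b j, x - k⟫ + ∑ j, lam j * ⟪c j, k - x⟫ := by
      rw [← Finset.sum_add_distrib]
      refine Finset.sum_congr rfl fun j _ => ?_
      rw [inner_sub_left, ← neg_sub k x, inner_neg_right, inner_neg_right]
      ring
    linarith
  have hterm : ∀ j, lam j * (‖b' j - c j‖ ^ 2 + ‖y' j - x‖ ^ 2)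
        + lam j * (‖b' j - b j‖ ^ 2 + ‖y' j - y j‖ ^ 2)
        + 2 * (lam j * ⟪k - y j + b j - c j, x - k⟫)
      ≤ lam j * (‖b j - c j‖ ^ 2 + ‖y j - x‖ ^ 2) := by
    intro j
    have hpq : 0 ≤ ⟪b' j - c j, y' j - x⟫ := by
      have h1 := hy j x (hx.mem_constraint j)
      have h2 := hx.subgradient j (y' j) (hyC j)
      rw [← neg_sub (y' j) x, inner_neg_right] at h1
      refine nonneg_of_mul_nonneg_right (a := lam j) ?_ (hlam j)
      rw [inner_sub_left]
      linarith
    have h := sq_norm_descent hpq (hmono j)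
    have hk' : k = b' j - b j + y' j := by rw [hb j]; abel
    rw [show b' j - c j + (y' j - y j) = k - y j + b j - c j by rw [hk']; abel,
      show -(b' j - b j + (y' j - x)) = x - k by rw [hk']; abel,
      show b' j - c j - (b' j - b j) = b j - c j by abel,
      show y' j - x - (y' j - y j) = y j - x by abel] at h
    have := mul_le_mul_of_nonneg_left h (hlam j).le
    linarith
  have := Finset.sum_le_sum fun j (_ : j ∈ Finset.univ) => hterm j
  rw [Finset.sum_add_distrib, Finset.sum_add_distrib, ← Finset.mul_sum] at this
  linarith

/-- If a positively weighted sum of squared norms tends to zero, so does each of the sequences. -/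
lemma tendsto_zero_of_tendsto_weighted_sum {E : Type*} [NormedAddCommGroup E]
    {ι : Type*} [Fintype ι] {lam : ι → ℝ} (hlam : ∀ j, 0 < lam j)
    {u v : ℕ → ι → E} (h : Tendsto (fun i => ∑ j, lam j * (‖u i j‖ ^ 2 + ‖v i j‖ ^ 2)) atTop (𝓝 0)) (j : ι) :
    Tendsto (fun i => u i j) atTop (𝓝 0) ∧ Tendsto (fun i => v i j) atTop (𝓝 0) := by
  have key : ∀ w : ℕ → E, (∀ i, ‖w i‖ ^ 2 ≤ ‖u i j‖ ^ 2 + ‖v i j‖ ^ 2) →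
      Tendsto w atTop (𝓝 0) := by
    intro w hw
    have hsq : Tendsto (fun i => ‖w i‖ ^ 2) atTop (𝓝 0) := by
      refine squeeze_zero (fun i => by positivity) (fun i => ?_)
        (by simpa using h.const_mul (lam j)⁻¹)
      have h1 : lam j * (‖u i j‖ ^ 2 + ‖v i j‖ ^ 2)
          ≤ ∑ j, lam j * (‖u i j‖ ^ 2 + ‖v i j‖ ^ 2) :=
        Finset.single_le_sum (f := fun j => lam j * (‖u i j‖ ^ 2 + ‖v i j‖ ^ 2))
          (fun j _ => mul_nonneg (hlam j).le (by positivity)) (Finset.mem_univ j)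
      rw [inv_mul_eq_div, le_div_iff₀ (hlam j)]
      nlinarith [hw i, hlam j]
    have := hsq.sqrt
    simp only [Real.sqrt_sq (norm_nonneg _), Real.sqrt_zero] at this
    exact tendsto_zero_iff_norm_tendsto_zero.2 this
  exact ⟨key _ fun i => le_add_of_nonneg_right (by positivity),
    key _ fun i => le_add_of_nonneg_left (by positivity)⟩

/-- A bounded weighted distance bounds the sequence. -/
lemma exists_bound_of_weighted_sum_le {E : Type*} [NormedAddCommGroup E]
    {ι : Type*} [Fintype ι] {lam : ι → ℝ} (hlam : ∀ j, 0 < lam j) {u v : ℕ → ι → E} {x : E} {c : ι → E} {B : ℝ}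
    (h : ∀ i, ∑ j, lam j * (‖u i j - c j‖ ^ 2 + ‖v i j - x‖ ^ 2) ≤ B) :
    Bornology.IsBounded (Set.range fun i => (u i, v i)) := by
  have hone : ∀ i j, ‖u i j - c j‖ ^ 2 + ‖v i j - x‖ ^ 2 ≤ B / lam j := by
    intro i j
    rw [le_div_iff₀' (hlam j)]
    exact (Finset.single_le_sum (f := fun j => lam j * (‖u i j - c j‖ ^ 2 + ‖v i j - x‖ ^ 2))
      (fun j _ => mul_nonneg (hlam j).le (by positivity)) (Finset.mem_univ j)).trans (h i)
  have hb : ∀ {a r : E} {D : ℝ}, ‖a - r‖ ^ 2 ≤ D → a ∈ Metric.closedBall r √D := fun hD => by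
    rw [mem_closedBall_iff_norm]
    exact Real.le_sqrt_of_sq_le hD
  refine ((Bornology.IsBounded.pi fun j => Metric.isBounded_closedBall (x := c j)
      (r := √(B / lam j))).prod (Bornology.IsBounded.pi fun j =>
      Metric.isBounded_closedBall (x := x) (r := √(B / lam j)))).subset ?_
  rintro _ ⟨i, rfl⟩
  refine ⟨fun j _ => hb ?_, fun j _ => hb ?_⟩
  · nlinarith [hone i j, sq_nonneg ‖v i j - x‖]
  · nlinarith [hone i j, sq_nonneg ‖u i j - c j‖]

/-- Convergence of two-block ADMM for `F x + ∑ j, G j x`, stated for iterates satisfying the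
first-order optimality conditions of the subproblems. -/
theorem admm_converges_of_variational [FiniteDimensional ℝ E] {ι : Type*} [Fintype ι] [Nonempty ι]
    {lam : ι → ℝ} (hlam : ∀ j, 0 < lam j)
    {S : Set E} {F : E → ℝ} {C : ι → Set E} {G : ι → E → ℝ}
    (hS : IsClosed S) (hF : Continuous F) (hC : ∀ j, IsClosed (C j)) (hG : ∀ j, Continuous (G j))
    {x : E} {c : ι → E} (hx : IsPrimalDual lam S F C G x c)
    {K : ℕ → E} {Y b : ℕ → ι → E}
    (hKS : ∀ i, K (i + 1) ∈ S)
    (hK : ∀ i, ∀ w ∈ S,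
      0 ≤ F w - F (K (i + 1)) + ∑ j, lam j * ⟪K (i + 1) - Y i j + b i j, w - K (i + 1)⟫)
    (hYC : ∀ i j, Y (i + 1) j ∈ C j)
    (hY : ∀ i j, ∀ w ∈ C j,
      lam j * ⟪b (i + 1) j, w - Y (i + 1) j⟫ ≤ G j w - G j (Y (i + 1) j))
    (hb : ∀ i j, b (i + 1) j = b i j + K (i + 1) - Y (i + 1) j) :
    ∃ (x' : E) (c' : ι → E), Tendsto K atTop (𝓝 x') ∧
      (∀ j, Tendsto (fun i => Y i j) atTop (𝓝 x')) ∧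
      (∀ j, Tendsto (fun i => b i j) atTop (𝓝 (c' j))) ∧
      IsPrimalDual lam S F C G x' c' := by
  have hmono : ∀ i j, 0 ≤ ⟪b (i + 1 + 1) j - b (i + 1) j, Y (i + 1 + 1) j - Y (i + 1) j⟫ := by
    intro i j
    have h1 := hY i j _ (hYC (i + 1) j)
    have h2 := hY (i + 1) j _ (hYC i j)
    rw [← neg_sub (Y (i + 1 + 1) j), inner_neg_right] at h2
    refine nonneg_of_mul_nonneg_right (a := lam j) ?_ (hlam j)
    rw [inner_sub_left]
    linarith
  set V : E → (ι → E) → ℕ → ℝ := fun x c i =>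
    ∑ j, lam j * (‖b (i + 1) j - c j‖ ^ 2 + ‖Y (i + 1) j - x‖ ^ 2) with hV
  set D : ℕ → ℝ := fun i => ∑ j, lam j *
    (‖b (i + 1 + 1) j - b (i + 1) j‖ ^ 2 + ‖Y (i + 1 + 1) j - Y (i + 1) j‖ ^ 2) with hD
  have hstep : ∀ {x c}, IsPrimalDual lam S F C G x c → ∀ i, V x c (i + 1) + D i ≤ V x c i :=
    fun hx i => hx.admm_step hlam (hKS (i + 1)) (hK (i + 1)) (hYC (i + 1)) (hY (i + 1))
      (hb (i + 1)) (hmono i)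
  have hD0 : ∀ i, 0 ≤ D i := fun i =>
    Finset.sum_nonneg fun j _ => mul_nonneg (hlam j).le (by positivity)
  have hV0 : ∀ x c i, 0 ≤ V x c i := fun x c i =>
    Finset.sum_nonneg fun j _ => mul_nonneg (hlam j).le (by positivity)
  have hanti : ∀ {x c}, IsPrimalDual lam S F C G x c → Antitone (V x c) := fun hx =>
    antitone_nat_of_succ_le fun i => by linarith [hstep hx i, hD0 i]
  have hDlim : Tendsto D atTop (𝓝 0) := by
    have hlim := tendsto_atTop_ciInf (hanti hx) ⟨0, by rintro _ ⟨i, rfl⟩; exact hV0 x c i⟩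
    refine squeeze_zero (g := fun i => V x c i - V x c (i + 1)) hD0
      (fun i => by linarith [hstep hx i])
      (by simpa using hlim.sub (hlim.comp (tendsto_add_atTop_nat 1)))
  have hdiff := tendsto_zero_of_tendsto_weighted_sum hlam hDlim
  obtain ⟨⟨c', y'⟩, -, φ, hφ, hlim⟩ := tendsto_subseq_of_bounded
    (exists_bound_of_weighted_sum_le hlam (u := fun i => b (i + 1)) (v := fun i => Y (i + 1))
      (fun i => hanti hx (Nat.zero_le i))) (fun i => Set.mem_range_self i)
  have hblim : ∀ j, Tendsto (fun i => b (φ i + 1) j) atTop (𝓝 (c' j)) := fun j =>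
    (((continuous_apply j).comp continuous_fst).tendsto (c', y')).comp hlim
  have hYlim : ∀ j, Tendsto (fun i => Y (φ i + 1) j) atTop (𝓝 (y' j)) := fun j =>
    (((continuous_apply j).comp continuous_snd).tendsto (c', y')).comp hlim
  have hbd : ∀ j, Tendsto (fun i => b (φ i + 1 + 1) j - b (φ i + 1) j) atTop (𝓝 0) := fun j =>
    (hdiff j).1.comp hφ.tendsto_atTop
  have hYd : ∀ j, Tendsto (fun i => Y (φ i + 1 + 1) j - Y (φ i + 1) j) atTop (𝓝 0) := fun j =>
    (hdiff j).2.comp hφ.tendsto_atTop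
  have hblim' : ∀ j, Tendsto (fun i => b (φ i + 1 + 1) j) atTop (𝓝 (c' j)) := fun j => by
    simpa using (hbd j).add (hblim j)
  have hYlim' : ∀ j, Tendsto (fun i => Y (φ i + 1 + 1) j) atTop (𝓝 (y' j)) := fun j => by
    simpa using (hYd j).add (hYlim j)
  have hKeq : ∀ i j, K (i + 1) = Y (i + 1) j + (b (i + 1) j - b i j) := fun i j => by
    rw [hb i j]; abel
  have hKlim : ∀ j, Tendsto (fun i => K (φ i + 1 + 1)) atTop (𝓝 (y' j)) := fun j => by
    simp only [fun i => hKeq (φ i + 1) j]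
    simpa using (hYlim' j).add (hbd j)
  obtain ⟨j₀⟩ := ‹Nonempty ι›
  set x' := y' j₀
  have hy' : ∀ j, y' j = x' := fun j => tendsto_nhds_unique (hKlim j) (hKlim j₀)
  simp only [hy'] at hYlim hYlim' hKlim
  have hpd : IsPrimalDual lam S F C G x' c' := by
    refine ⟨hS.mem_of_tendsto (hKlim j₀) (.of_forall fun i => hKS _),
      fun j => (hC j).mem_of_tendsto (hYlim j) (.of_forall fun i => hYC _ j),
      fun w hw => ?_, fun j w hw => ?_⟩
    · refine ge_of_tendsto (x := atTop) (f := fun i => F w - F (K (φ i + 1 + 1)) + ∑ j, lam j *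
        ⟪K (φ i + 1 + 1) - Y (φ i + 1) j + b (φ i + 1) j, w - K (φ i + 1 + 1)⟫) ?_
        (.of_forall fun i => hK (φ i + 1) w hw)
      refine (tendsto_const_nhds.sub ((hF.tendsto x').comp (hKlim j₀))).add
        (tendsto_finsetSum _ fun j _ => ?_)
      have h1 := ((hKlim j₀).sub (hYlim j)).add (hblim j)
      rw [sub_self, zero_add] at h1
      exact (h1.inner (tendsto_const_nhds.sub (hKlim j₀))).const_mul _
    · exact le_of_tendsto_of_tendsto'
        (((hblim j).inner (tendsto_const_nhds.sub (hYlim j))).const_mul _)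
        (tendsto_const_nhds.sub (((hG j).tendsto x').comp (hYlim j)))
        fun i => hY (φ i) j w hw
  have hVlim : Tendsto (V x' c') atTop (𝓝 0) := by
    rw [tendsto_iff_tendsto_subseq_of_antitone (hanti hpd) hφ.tendsto_atTop]
    have h1 : Tendsto (V x' c' ∘ φ) atTop
        (𝓝 (∑ j, lam j * (‖c' j - c' j‖ ^ 2 + ‖x' - x'‖ ^ 2))) :=
      tendsto_finsetSum _ fun j _ => ((((hblim j).sub_const _).norm.pow 2).add
        (((hYlim j).sub_const _).norm.pow 2)).const_mul _
    simpa using h1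
  have hfin := tendsto_zero_of_tendsto_weighted_sum hlam hVlim
  have hbfin : ∀ j, Tendsto (fun i => b i j) atTop (𝓝 (c' j)) := fun j => by
    rw [← tendsto_add_atTop_iff_nat 1]
    simpa using (hfin j).1.add_const (c' j)
  have hYfin : ∀ j, Tendsto (fun i => Y i j) atTop (𝓝 x') := fun j => by
    rw [← tendsto_add_atTop_iff_nat 1]
    simpa using (hfin j).2.add_const x'
  refine ⟨x', c', ?_, hYfin, hbfin, hpd⟩
  rw [← tendsto_add_atTop_iff_nat 1]
  simp only [fun i => hKeq i j₀]
  simpa using ((tendsto_add_atTop_iff_nat 1).2 (hYfin j₀)).add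
    (((tendsto_add_atTop_iff_nat 1).2 (hbfin j₀)).sub (hbfin j₀))

/-- Convergence of two-block ADMM for `F x + ∑ j, G j x`. -/
theorem admm_converges_of_isMin [FiniteDimensional ℝ E] {ι : Type*} [Fintype ι] [Nonempty ι]
    {lam : ι → ℝ} (hlam : ∀ j, 0 < lam j)
    {S : Set E} {F : E → ℝ} {C : ι → Set E} {G : ι → E → ℝ}
    (hS : IsClosed S) (hF : Continuous F) (hC : ∀ j, IsClosed (C j)) (hG : ∀ j, Continuous (G j))
    (hFc : ConvexOn ℝ S F) (hGc : ∀ j, ConvexOn ℝ (C j) (G j))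
    {x : E} {c : ι → E} (hxS : x ∈ S) (hxC : ∀ j, x ∈ C j)
    (hx : ∀ w ∈ S, F x + ∑ j, lam j / 2 * ‖x - x + c j‖ ^ 2
      ≤ F w + ∑ j, lam j / 2 * ‖w - x + c j‖ ^ 2)
    (hxG : ∀ j, ∀ w ∈ C j, G j x + lam j / 2 * ‖x - x + c j‖ ^ 2
      ≤ G j w + lam j / 2 * ‖x - w + c j‖ ^ 2)
    {K : ℕ → E} {Y b : ℕ → ι → E}
    (hKS : ∀ i, K (i + 1) ∈ S)
    (hK : ∀ i, ∀ w ∈ S,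
      F (K (i + 1)) + ∑ j, lam j / 2 * ‖K (i + 1) - Y i j + b i j‖ ^ 2
        ≤ F w + ∑ j, lam j / 2 * ‖w - Y i j + b i j‖ ^ 2)
    (hYC : ∀ i j, Y (i + 1) j ∈ C j)
    (hY : ∀ i j, ∀ w ∈ C j,
      G j (Y (i + 1) j) + lam j / 2 * ‖K (i + 1) - Y (i + 1) j + b i j‖ ^ 2
        ≤ G j w + lam j / 2 * ‖K (i + 1) - w + b i j‖ ^ 2)
    (hb : ∀ i j, b (i + 1) j = b i j + K (i + 1) - Y (i + 1) j) :
    ∃ (x' : E) (c' : ι → E), Tendsto K atTop (𝓝 x') ∧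
      (∀ j, Tendsto (fun i => Y i j) atTop (𝓝 x')) ∧
      (∀ j, Tendsto (fun i => b i j) atTop (𝓝 (c' j))) ∧
      x' ∈ S ∧ (∀ j, x' ∈ C j) ∧ F x' + ∑ j, G j x' = F x + ∑ j, G j x := by
  have hVF : ∀ {k : E} {y d : ι → E}, k ∈ S →
      (∀ w ∈ S, F k + ∑ j, lam j / 2 * ‖k - y j + d j‖ ^ 2
        ≤ F w + ∑ j, lam j / 2 * ‖w - y j + d j‖ ^ 2) →
      ∀ w ∈ S, 0 ≤ F w - F k + ∑ j, lam j * ⟪k - y j + d j, w - k⟫ := by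
    intro k y d hk hmin w hw
    have hrw : ∀ (w : E) j, w - y j + d j = w + -(y j - d j) := fun w j => by abel
    simp only [hrw] at hmin ⊢
    exact hFc.variational_of_isMin_add_sum_sq lam (fun j => -(y j - d j)) hk hmin hw
  have hVG : ∀ {j : ι} {k y d : E}, y ∈ C j →
      (∀ w ∈ C j, G j y + lam j / 2 * ‖k - y + d‖ ^ 2 ≤ G j w + lam j / 2 * ‖k - w + d‖ ^ 2) →
      ∀ w ∈ C j, lam j * ⟪d + k - y, w - y⟫ ≤ G j w - G j y := by
    intro j k y d hy hmin w hw
    have hrev : ∀ w : E, ‖k - w + d‖ = ‖w + -(k + d)‖ := fun w => by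
      rw [← norm_neg]; congr 1; abel
    simp only [hrev] at hmin
    have h := (hGc j).variational_of_isMin_add_sum_sq (ι := Unit) (fun _ => lam j)
      (fun _ => -(k + d)) hy (by simpa using hmin) hw
    rw [Fintype.sum_unique, show y + -(k + d) = -(d + k - y) by abel, inner_neg_left] at h
    linarith
  have hpd : IsPrimalDual lam S F C G x c := by
    refine ⟨hxS, hxC, fun w hw => ?_, fun j w hw => ?_⟩
    · simpa using hVF hxS hx w hw
    · simpa using hVG (hxC j) (hxG j) w hw
  obtain ⟨x', c', h1, h2, h3, h4⟩ := admm_converges_of_variational hlam hS hF hC hG hpd hKS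
    (fun i => hVF (hKS i) (hK i)) hYC
    (fun i j w hw => by rw [hb i j]; exact hVG (hYC i j) (hY i j) w hw) hb
  exact ⟨x', c', h1, h2, h3, h4.mem, h4.mem_constraint,
    le_antisymm (h4.objective_le hpd) (hpd.objective_le h4)⟩

end Abstract

section MatrixFacts

open Filter Topology

lemma frobSq_nonneg {n m : ℕ} (X : Matrix (Fin n) (Fin m) ℝ) : 0 ≤ frobSq X :=
  Finset.sum_nonneg fun _ _ => Finset.sum_nonneg fun _ _ => sq_nonneg _

lemma frobSq_eq_zero {n m : ℕ} {X : Matrix (Fin n) (Fin m) ℝ} : frobSq X = 0 ↔ X = 0 := by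
  refine ⟨fun h => ?_, fun h => by simp [h, frobSq]⟩
  ext i j
  have hrow := (Finset.sum_eq_zero_iff_of_nonneg fun i _ =>
    Finset.sum_nonneg fun j _ => sq_nonneg (X i j)).1 h i (Finset.mem_univ i)
  have hentry := (Finset.sum_eq_zero_iff_of_nonneg fun j _ => sq_nonneg (X i j)).1 hrow j
    (Finset.mem_univ j)
  exact pow_eq_zero_iff two_ne_zero |>.1 hentry

lemma mInner_eq_sum {n : ℕ} (X Y : Matrix (Fin n) (Fin n) ℝ) :
    mInner X Y = ∑ i, ∑ j, X i j * Y i j := by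
  rw [mInner, Finset.sum_comm]
  simp [Matrix.trace, Matrix.mul_apply]

lemma mInner_self {n : ℕ} (X : Matrix (Fin n) (Fin n) ℝ) : mInner X X = frobSq X := by
  simp [mInner_eq_sum, frobSq, sq]

lemma mInner_add_right {n : ℕ} (X Y Z : Matrix (Fin n) (Fin n) ℝ) :
    mInner X (Y + Z) = mInner X Y + mInner X Z := by
  simp [mInner, mul_add]

lemma frobSq_add {n : ℕ} (X Y : Matrix (Fin n) (Fin n) ℝ) :
    frobSq (X + Y) = frobSq X + 2 * mInner X Y + frobSq Y := by
  simp only [frobSq, mInner_eq_sum, Finset.mul_sum, ← Finset.sum_add_distrib, Matrix.add_apply]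
  refine Finset.sum_congr rfl fun i _ => Finset.sum_congr rfl fun j _ => ?_
  ring

lemma frobenius_norm_sq_eq_frobSq {n : ℕ} (X : Matrix (Fin n) (Fin n) ℝ) :
    @norm _ Matrix.frobeniusNormedAddCommGroup.toNorm X ^ 2 = frobSq X := by
  rw [Matrix.frobenius_norm_def, ← Real.sqrt_eq_rpow,
    Real.sq_sqrt (Finset.sum_nonneg fun _ _ => Finset.sum_nonneg fun _ _ => by positivity)]
  simp [frobSq]

/-- The Frobenius inner product on square matrices, inducing the Frobenius norm. -/
@[reducible]
noncomputable def frobeniusInnerProductSpace (n : ℕ) :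
    @InnerProductSpace ℝ (Matrix (Fin n) (Fin n) ℝ) _
      Matrix.frobeniusNormedAddCommGroup.toSeminormedAddCommGroup :=
  letI := @Matrix.frobeniusNormedAddCommGroup (Fin n) (Fin n) ℝ _ _ _
  { Matrix.frobeniusNormedSpace with
    inner := mInner
    norm_sq_eq_re_inner := fun X => by
      rw [frobenius_norm_sq_eq_frobSq, mInner_self]
      rfl
    conj_inner_symm := fun X Y => by simp [mInner_eq_sum, mul_comm]
    add_left := fun X Y Z => by simp [mInner, add_mul]
    smul_left := fun X Y r => by simp [mInner] }

/-- Convergence of two-block ADMM for matrix variables, in terms of the squared Frobenius norm. -/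
theorem admm_converges_of_isMin_frobSq {n : ℕ} {ι : Type*} [Fintype ι] [Nonempty ι]
    {lam : ι → ℝ} (hlam : ∀ j, 0 < lam j)
    {S : Set (Matrix (Fin n) (Fin n) ℝ)} {F : Matrix (Fin n) (Fin n) ℝ → ℝ}
    {C : ι → Set (Matrix (Fin n) (Fin n) ℝ)} {G : ι → Matrix (Fin n) (Fin n) ℝ → ℝ}
    (hS : IsClosed S) (hF : Continuous F) (hC : ∀ j, IsClosed (C j)) (hG : ∀ j, Continuous (G j))
    (hFc : ConvexOn ℝ S F) (hGc : ∀ j, ConvexOn ℝ (C j) (G j))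
    {x : Matrix (Fin n) (Fin n) ℝ} {c : ι → Matrix (Fin n) (Fin n) ℝ}
    (hxS : x ∈ S) (hxC : ∀ j, x ∈ C j)
    (hx : ∀ w ∈ S, F x + ∑ j, lam j / 2 * frobSq (x - x + c j)
      ≤ F w + ∑ j, lam j / 2 * frobSq (w - x + c j))
    (hxG : ∀ j, ∀ w ∈ C j, G j x + lam j / 2 * frobSq (x - x + c j)
      ≤ G j w + lam j / 2 * frobSq (x - w + c j))
    {K : ℕ → Matrix (Fin n) (Fin n) ℝ} {Y b : ℕ → ι → Matrix (Fin n) (Fin n) ℝ}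
    (hKS : ∀ i, K (i + 1) ∈ S)
    (hK : ∀ i, ∀ w ∈ S,
      F (K (i + 1)) + ∑ j, lam j / 2 * frobSq (K (i + 1) - Y i j + b i j)
        ≤ F w + ∑ j, lam j / 2 * frobSq (w - Y i j + b i j))
    (hYC : ∀ i j, Y (i + 1) j ∈ C j)
    (hY : ∀ i j, ∀ w ∈ C j,
      G j (Y (i + 1) j) + lam j / 2 * frobSq (K (i + 1) - Y (i + 1) j + b i j)
        ≤ G j w + lam j / 2 * frobSq (K (i + 1) - w + b i j))
    (hb : ∀ i j, b (i + 1) j = b i j + K (i + 1) - Y (i + 1) j) :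
    ∃ (x' : Matrix (Fin n) (Fin n) ℝ) (c' : ι → Matrix (Fin n) (Fin n) ℝ),
      Tendsto K atTop (𝓝 x') ∧
      (∀ j, Tendsto (fun i => Y i j) atTop (𝓝 x')) ∧
      (∀ j, Tendsto (fun i => b i j) atTop (𝓝 (c' j))) ∧
      x' ∈ S ∧ (∀ j, x' ∈ C j) ∧ F x' + ∑ j, G j x' = F x + ∑ j, G j x := by
  simp only [← frobenius_norm_sq_eq_frobSq] at hx hxG hK hY
  exact @admm_converges_of_isMin _ Matrix.frobeniusNormedAddCommGroup
    (frobeniusInnerProductSpace n) (inferInstanceAs (FiniteDimensional ℝ (Matrix _ _ ℝ)))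
    ι _ _ lam hlam S F C G hS hF hC hG hFc hGc
    x c hxS hxC hx hxG K Y b hKS hK hYC hY hb

lemma convexOn_half_frobSq_sub_mul {n p : ℕ} (A : Matrix (Fin n) (Fin p) ℝ)
    {S : Set (Matrix (Fin n) (Fin n) ℝ)} (hS : Convex ℝ S) :
    ConvexOn ℝ S fun K => 1 / 2 * frobSq (A - K * A) := by
  refine ⟨hS, fun U _ V _ a b ha hb hab => ?_⟩
  have hsplit : A - (a • U + b • V) * A = a • (A - U * A) + b • (A - V * A) := by
    rw [Matrix.add_mul, Matrix.smul_mul, Matrix.smul_mul]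
    nth_rw 1 [← one_smul ℝ A, ← hab]
    module
  simp only [hsplit, frobSq, smul_eq_mul, Finset.mul_sum, ← Finset.sum_add_distrib]
  refine Finset.sum_le_sum fun i _ => Finset.sum_le_sum fun j _ => ?_
  simp only [Matrix.add_apply, Matrix.smul_apply, smul_eq_mul]
  obtain rfl : b = 1 - a := by linarith
  nlinarith [mul_nonneg (mul_nonneg ha hb) (sq_nonneg ((A - U * A) i j - (A - V * A) i j))]

lemma convexOn_mul_sum_abs {n : ℕ} {θ : ℝ} (hθ : 0 ≤ θ) :
    ConvexOn ℝ Set.univ fun X : Matrix (Fin n) (Fin n) ℝ => θ * ∑ i, ∑ j, |X i j| := by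
  refine ⟨convex_univ, fun U _ V _ a b ha hb _ => ?_⟩
  have h : ∑ i, ∑ j, |(a • U + b • V) i j| ≤ a * ∑ i, ∑ j, |U i j| + b * ∑ i, ∑ j, |V i j| := by
    simp only [Finset.mul_sum, ← Finset.sum_add_distrib]
    refine Finset.sum_le_sum fun i _ => Finset.sum_le_sum fun j _ => ?_
    rw [Matrix.add_apply, Matrix.smul_apply, Matrix.smul_apply, smul_eq_mul, smul_eq_mul]
    refine (abs_add_le _ _).trans_eq ?_
    rw [abs_mul, abs_mul, abs_of_nonneg ha, abs_of_nonneg hb]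
  refine (mul_le_mul_of_nonneg_left h hθ).trans_eq ?_
  simp only [smul_eq_mul]
  ring

lemma convex_setOf_posSemidef_le_one (n : ℕ) :
    Convex ℝ {M : Matrix (Fin n) (Fin n) ℝ | M = Mᵀ ∧ M.PosSemidef ∧ (1 - M).PosSemidef} := by
  rintro U ⟨hU, hU0, hU1⟩ V ⟨hV, hV0, hV1⟩ a b ha hb hab
  refine ⟨?_, (hU0.smul ha).add (hV0.smul hb), ?_⟩
  · rw [Matrix.transpose_add, Matrix.transpose_smul, Matrix.transpose_smul, ← hU, ← hV]
  · convert (hU1.smul ha).add (hV1.smul hb) using 1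
    nth_rw 1 [← one_smul ℝ (1 : Matrix (Fin n) (Fin n) ℝ), ← hab]
    module

lemma isClosed_setOf_posSemidef (n : ℕ) :
    IsClosed {M : Matrix (Fin n) (Fin n) ℝ | M.PosSemidef} := by
  simp only [Matrix.posSemidef_iff_dotProduct_mulVec, Set.ofPred_and, Set.ofPred_forall]
  refine IsClosed.inter (isClosed_eq continuous_id.matrix_conjTranspose continuous_id)
    (isClosed_iInter fun v => isClosed_le continuous_const ?_)
  exact continuous_const.dotProduct (continuous_id.matrix_mulVec continuous_const)

lemma isClosed_setOf_posSemidef_le_one (n : ℕ) :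
    IsClosed {M : Matrix (Fin n) (Fin n) ℝ | M = Mᵀ ∧ M.PosSemidef ∧ (1 - M).PosSemidef} :=
  (isClosed_eq continuous_id continuous_id.matrix_transpose).inter
    ((isClosed_setOf_posSemidef n).inter
      ((isClosed_setOf_posSemidef n).preimage (continuous_const.sub continuous_id)))

end MatrixFacts

section ExtendedReal

variable {n p : ℕ} {A : Matrix (Fin n) (Fin p) ℝ} {J : ℕ} {θ lam1 lam2 lam3 : ℝ}

lemma exists_trace_eq (hn : 0 < n) (r : ℝ) : ∃ W : Matrix (Fin n) (Fin n) ℝ, W.trace = r := by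
  have hn' : (n : ℝ) ≠ 0 := by positivity
  exact ⟨(r / n) • 1, by simp [Matrix.trace_smul, hn']⟩

lemma convex_setOf_trace_eq (n J : ℕ) :
    Convex ℝ {W : Matrix (Fin n) (Fin n) ℝ | W.trace = J} := by
  intro U hU V hV a b _ _ hab
  simp only [Set.mem_ofPred_eq] at hU hV ⊢
  rw [Matrix.trace_add, Matrix.trace_smul, Matrix.trace_smul, hU, hV, ← add_smul, hab, one_smul]

lemma convex_setOf_entrywise_nonneg (n : ℕ) :
    Convex ℝ {Z : Matrix (Fin n) (Fin n) ℝ | ∀ i j, 0 ≤ Z i j} :=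
  fun _ hU _ hV _ _ ha hb _ i j =>
    add_nonneg (mul_nonneg ha (hU i j)) (mul_nonneg hb (hV i j))

lemma isClosed_setOf_entrywise_nonneg (n : ℕ) :
    IsClosed {Z : Matrix (Fin n) (Fin n) ℝ | ∀ i j, 0 ≤ Z i j} := by
  simp only [Set.ofPred_forall]
  exact isClosed_iInter fun i => isClosed_iInter fun j =>
    isClosed_le continuous_const (continuous_id.matrix_elem i j)

lemma trace_eq_of_fObj_add_le {K W : Matrix (Fin n) (Fin n) ℝ} {r s : ℝ} (hW : W.trace = J)
    (h : fObj A J K + (r : EReal) ≤ fObj A J W + (s : EReal)) : K.trace = J := by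
  by_contra hK
  rw [fObj, fObj, if_neg hK, if_pos hW, EReal.top_add_coe, ← EReal.coe_add, top_le_iff] at h
  exact EReal.coe_ne_top _ h

lemma mem_of_hObj_add_le {M W : Matrix (Fin n) (Fin n) ℝ} {r s : ℝ}
    (hW : W = Wᵀ ∧ W.PosSemidef ∧ (1 - W).PosSemidef)
    (h : hObj M + (r : EReal) ≤ hObj W + (s : EReal)) :
    M = Mᵀ ∧ M.PosSemidef ∧ (1 - M).PosSemidef := by
  by_contra hM
  rw [hObj, hObj, if_neg hM, if_pos hW, EReal.top_add_coe, zero_add, top_le_iff] at h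
  exact EReal.coe_ne_top _ h

lemma mem_of_dObj_add_le {Z W : Matrix (Fin n) (Fin n) ℝ} {r s : ℝ} (hW : ∀ i j, 0 ≤ W i j)
    (h : dObj Z + (r : EReal) ≤ dObj W + (s : EReal)) : ∀ i j, 0 ≤ Z i j := by
  by_contra hZ
  rw [dObj, dObj, if_neg hZ, if_pos hW, EReal.top_add_coe, zero_add, top_le_iff] at h
  exact EReal.coe_ne_top _ h

lemma fObj_add_eq_coe {K M X Z : Matrix (Fin n) (Fin n) ℝ} (hK : K.trace = J)
    (hM : M = Mᵀ ∧ M.PosSemidef ∧ (1 - M).PosSemidef) (hZ : ∀ i j, 0 ≤ Z i j) :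
    fObj A J K + hObj M + gObj θ X + dObj Z
      = ((1 / 2 * frobSq (A - K * A) + θ * ∑ i, ∑ j, |X i j| : ℝ) : EReal) := by
  rw [fObj, hObj, gObj, dObj, if_pos hK, if_pos hM, if_pos hZ, add_zero, add_zero, EReal.coe_add]

lemma fObj_add_eq_top {K M X Z : Matrix (Fin n) (Fin n) ℝ}
    (h : ¬(K.trace = J ∧ (M = Mᵀ ∧ M.PosSemidef ∧ (1 - M).PosSemidef) ∧ ∀ i j, 0 ≤ Z i j)) :
    fObj A J K + hObj M + gObj θ X + dObj Z = ⊤ := by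
  unfold fObj hObj gObj dObj
  split_ifs with hK hM hZ hZ hM hZ hZ
  · exact absurd ⟨hK, hM, hZ⟩ h
  all_goals simp only [add_zero, ← EReal.coe_add, EReal.coe_add_top, EReal.top_add_coe,
    EReal.top_add_top]

/-- A saddle point of the Lagrangian is feasible, and each of its blocks solves the corresponding
ADMM subproblem. -/
lemma IsSaddle.kkt_of_exists_trace {Ks Ms Xs Zs b1s b2s b3s : Matrix (Fin n) (Fin n) ℝ}
    (hs : IsSaddle A J θ lam1 lam2 lam3 Ks Ms Xs Zs b1s b2s b3s)
    (h1 : 0 < lam1) (h2 : 0 < lam2) (h3 : 0 < lam3)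
    (htr : ∃ W : Matrix (Fin n) (Fin n) ℝ, W.trace = J) :
    Ks.trace = J ∧ (Ks = Ksᵀ ∧ Ks.PosSemidef ∧ (1 - Ks).PosSemidef) ∧ (∀ i j, 0 ≤ Ks i j) ∧
    Ks = Ms ∧ Ks = Xs ∧ Ks = Zs ∧
    (∀ W : Matrix (Fin n) (Fin n) ℝ, W.trace = J →
      1 / 2 * frobSq (A - Ks * A) + lam1 / 2 * frobSq (Ks - Ks + b1s)
          + lam2 / 2 * frobSq (Ks - Ks + b2s) + lam3 / 2 * frobSq (Ks - Ks + b3s)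
        ≤ 1 / 2 * frobSq (A - W * A) + lam1 / 2 * frobSq (W - Ks + b1s)
          + lam2 / 2 * frobSq (W - Ks + b2s) + lam3 / 2 * frobSq (W - Ks + b3s)) ∧
    (∀ W : Matrix (Fin n) (Fin n) ℝ, W = Wᵀ ∧ W.PosSemidef ∧ (1 - W).PosSemidef →
      lam1 / 2 * frobSq (Ks - Ks + b1s) ≤ lam1 / 2 * frobSq (Ks - W + b1s)) ∧
    (∀ W : Matrix (Fin n) (Fin n) ℝ,
      θ * ∑ i, ∑ j, |Ks i j| + lam2 / 2 * frobSq (Ks - Ks + b2s)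
        ≤ θ * ∑ i, ∑ j, |W i j| + lam2 / 2 * frobSq (Ks - W + b2s)) ∧
    (∀ W : Matrix (Fin n) (Fin n) ℝ, (∀ i j, 0 ≤ W i j) →
      lam3 / 2 * frobSq (Ks - Ks + b3s) ≤ lam3 / 2 * frobSq (Ks - W + b3s)) := by
  obtain ⟨hdual, hprimal⟩ := hs
  have hfeas : Ks.trace = J ∧ (Ms = Msᵀ ∧ Ms.PosSemidef ∧ (1 - Ms).PosSemidef) ∧
      ∀ i j, 0 ≤ Zs i j := by
    by_contra hcon
    obtain ⟨W, hW⟩ := htr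
    have h := hprimal W 0 0 0
    rw [Lag, Lag, fObj_add_eq_top hcon, fObj_add_eq_coe hW
      ⟨by simp, Matrix.PosSemidef.zero, by simpa using Matrix.PosSemidef.one⟩ (by simp),
      EReal.top_add_coe, EReal.top_add_coe, EReal.top_add_coe, ← EReal.coe_add, ← EReal.coe_add,
      ← EReal.coe_add, top_le_iff] at h
    exact EReal.coe_ne_top _ h
  obtain ⟨hK, hM, hZ⟩ := hfeas
  simp only [Lag, fObj_add_eq_coe hK hM hZ, ← EReal.coe_add, EReal.coe_le_coe_iff] at hdual
  have heq : ∀ {l : ℝ} {D : Matrix (Fin n) (Fin n) ℝ}, 0 < l → l * frobSq D ≤ 0 → D = 0 :=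
    fun hl h => frobSq_eq_zero.1
      (le_antisymm (nonpos_of_mul_nonpos_right h hl) (frobSq_nonneg _))
  obtain rfl : Ks = Ms := by
    have h := hdual (b1s + (Ks - Ms)) b2s b3s
    rw [mInner_add_right, mInner_self] at h
    exact sub_eq_zero.1 (heq h1 (by linarith))
  obtain rfl : Ks = Xs := by
    have h := hdual b1s (b2s + (Ks - Xs)) b3s
    rw [mInner_add_right, mInner_self] at h
    exact sub_eq_zero.1 (heq h2 (by linarith))
  obtain rfl : Ks = Zs := by
    have h := hdual b1s b2s (b3s + (Ks - Zs))
    rw [mInner_add_right, mInner_self] at h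
    exact sub_eq_zero.1 (heq h3 (by linarith))
  have hreal : ∀ W M X Z : Matrix (Fin n) (Fin n) ℝ, W.trace = J →
      (M = Mᵀ ∧ M.PosSemidef ∧ (1 - M).PosSemidef) → (∀ i j, 0 ≤ Z i j) → _ :=
    fun W M X Z hW hM' hZ' => by
      have h := hprimal W M X Z
      simp only [Lag, fObj_add_eq_coe hK hM hZ, fObj_add_eq_coe hW hM' hZ', ← EReal.coe_add,
        EReal.coe_le_coe_iff] at h
      exact h
  refine ⟨hK, hM, hZ, rfl, rfl, rfl, fun W hW => ?_, fun W hW => ?_, fun W => ?_, fun W hW => ?_⟩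
  · have h := hreal W Ks Ks Ks hW hM hZ
    simp only [frobSq_add]
    linarith
  · have h := hreal Ks W Ks Ks hK hW hZ
    simp only [frobSq_add]
    linarith
  · have h := hreal Ks Ks W Ks hK hM hZ
    simp only [frobSq_add]
    linarith
  · have h := hreal Ks Ks Ks W hK hM hW
    simp only [frobSq_add]
    linarith

end ExtendedReal

/-- Convergence of the ADMM iteration for the convex relaxation (P): assuming the
Lagrangian admits a saddle point, from any initial point the iterates converge to a limit
with `K̃ = M̃ = X̃ = Z̃` attaining the optimal value. -/
theorem admm_converges {n p : ℕ} (A : Matrix (Fin n) (Fin p) ℝ) (J : ℕ) (hJ : 0 < J)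
    (θ lam1 lam2 lam3 : ℝ) (hθ : 0 < θ)
    (h1 : 0 < lam1) (h2 : 0 < lam2) (h3 : 0 < lam3)
    -- a saddle point of the Lagrangian
    (Ks Ms Xs Zs b1s b2s b3s : Matrix (Fin n) (Fin n) ℝ)
    (hsaddle : IsSaddle A J θ lam1 lam2 lam3 Ks Ms Xs Zs b1s b2s b3s)
    -- the ADMM iterates, from an arbitrary initial point
    (K M X Z b1 b2 b3 : ℕ → Matrix (Fin n) (Fin n) ℝ)
    (hK : ∀ i : ℕ, ∀ W : Matrix (Fin n) (Fin n) ℝ,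
      fObj A J (K (i + 1))
          + ((lam1 / 2 * frobSq (K (i + 1) - M i + b1 i)
            + lam2 / 2 * frobSq (K (i + 1) - X i + b2 i)
            + lam3 / 2 * frobSq (K (i + 1) - Z i + b3 i) : ℝ) : EReal)
        ≤ fObj A J W
          + ((lam1 / 2 * frobSq (W - M i + b1 i)
            + lam2 / 2 * frobSq (W - X i + b2 i)
            + lam3 / 2 * frobSq (W - Z i + b3 i) : ℝ) : EReal))
    (hM : ∀ i : ℕ, ∀ W : Matrix (Fin n) (Fin n) ℝ,
      hObj (M (i + 1)) + ((lam1 / 2 * frobSq (K (i + 1) - M (i + 1) + b1 i) : ℝ) : EReal)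
        ≤ hObj W + ((lam1 / 2 * frobSq (K (i + 1) - W + b1 i) : ℝ) : EReal))
    (hX : ∀ i : ℕ, ∀ W : Matrix (Fin n) (Fin n) ℝ,
      gObj θ (X (i + 1)) + ((lam2 / 2 * frobSq (K (i + 1) - X (i + 1) + b2 i) : ℝ) : EReal)
        ≤ gObj θ W + ((lam2 / 2 * frobSq (K (i + 1) - W + b2 i) : ℝ) : EReal))
    (hZ : ∀ i : ℕ, ∀ W : Matrix (Fin n) (Fin n) ℝ,
      dObj (Z (i + 1)) + ((lam3 / 2 * frobSq (K (i + 1) - Z (i + 1) + b3 i) : ℝ) : EReal)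
        ≤ dObj W + ((lam3 / 2 * frobSq (K (i + 1) - W + b3 i) : ℝ) : EReal))
    (hb1 : ∀ i : ℕ, b1 (i + 1) = b1 i + K (i + 1) - M (i + 1))
    (hb2 : ∀ i : ℕ, b2 (i + 1) = b2 i + K (i + 1) - X (i + 1))
    (hb3 : ∀ i : ℕ, b3 (i + 1) = b3 i + K (i + 1) - Z (i + 1)) :
    ∃ Kt Mt Xt Zt b1t b2t b3t : Matrix (Fin n) (Fin n) ℝ,
      Filter.Tendsto K Filter.atTop (nhds Kt) ∧
      Filter.Tendsto M Filter.atTop (nhds Mt) ∧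
      Filter.Tendsto X Filter.atTop (nhds Xt) ∧
      Filter.Tendsto Z Filter.atTop (nhds Zt) ∧
      Filter.Tendsto b1 Filter.atTop (nhds b1t) ∧
      Filter.Tendsto b2 Filter.atTop (nhds b2t) ∧
      Filter.Tendsto b3 Filter.atTop (nhds b3t) ∧
      Kt = Mt ∧ Mt = Xt ∧ Xt = Zt ∧
      fObj A J Kt + hObj Mt + gObj θ Xt + dObj Zt
        = fObj A J Ks + hObj Ms + gObj θ Xs + dObj Zs := by
  rcases Nat.eq_zero_or_pos n with rfl | hn
  · have hconst : ∀ s : ℕ → Matrix (Fin 0) (Fin 0) ℝ, Filter.Tendsto s Filter.atTop (nhds 0) :=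
      fun s => (tendsto_const_nhds (x := (0 : Matrix (Fin 0) (Fin 0) ℝ))).congr
        fun i => Subsingleton.elim _ _
    refine ⟨0, 0, 0, 0, 0, 0, 0, hconst K, hconst M, hconst X, hconst Z, hconst b1, hconst b2,
      hconst b3, rfl, rfl, rfl, ?_⟩
    rw [Subsingleton.elim Ks 0, Subsingleton.elim Ms 0, Subsingleton.elim Xs 0,
      Subsingleton.elim Zs 0]
  obtain ⟨W₀, hW₀⟩ := exists_trace_eq hn (J : ℝ)
  obtain ⟨htr, hMs, hZs, rfl, rfl, rfl, hsF, hsM, hsX, hsZ⟩ :=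
    hsaddle.kkt_of_exists_trace h1 h2 h3 ⟨W₀, hW₀⟩
  have hKS : ∀ i, (K (i + 1)).trace = J := fun i => trace_eq_of_fObj_add_le hW₀ (hK i W₀)
  have hMC : ∀ i, M (i + 1) = (M (i + 1))ᵀ ∧ (M (i + 1)).PosSemidef ∧
      (1 - M (i + 1)).PosSemidef := fun i => mem_of_hObj_add_le hMs (hM i Ks)
  have hZC : ∀ i a c, 0 ≤ Z (i + 1) a c := fun i => mem_of_dObj_add_le hZs (hZ i Ks)
  have hKr : ∀ i, ∀ W : Matrix (Fin n) (Fin n) ℝ, W.trace = J → _ := fun i W hW => by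
    have h := hK i W
    rw [fObj, fObj, if_pos (hKS i), if_pos hW, ← EReal.coe_add, ← EReal.coe_add,
      EReal.coe_le_coe_iff] at h
    exact h
  have hMr : ∀ i, ∀ W : Matrix (Fin n) (Fin n) ℝ,
      (W = Wᵀ ∧ W.PosSemidef ∧ (1 - W).PosSemidef) → _ := fun i W hW => by
    have h := hM i W
    rw [hObj, hObj, if_pos (hMC i), if_pos hW, zero_add, zero_add, EReal.coe_le_coe_iff] at h
    exact h
  have hXr : ∀ i, ∀ W : Matrix (Fin n) (Fin n) ℝ, _ := fun i W => by
    have h := hX i W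
    rw [gObj, gObj, ← EReal.coe_add, ← EReal.coe_add, EReal.coe_le_coe_iff] at h
    exact h
  have hZr : ∀ i, ∀ W : Matrix (Fin n) (Fin n) ℝ, (∀ i j, 0 ≤ W i j) → _ := fun i W hW => by
    have h := hZ i W
    rw [dObj, dObj, if_pos (hZC i), if_pos hW, zero_add, zero_add, EReal.coe_le_coe_iff] at h
    exact h
  obtain ⟨x, c, hKx, hYx, hbc, hxS, hxC, hobj⟩ := admm_converges_of_isMin_frobSq
    (lam := ![lam1, lam2, lam3]) (S := {W | W.trace = J})
    (F := fun W => 1 / 2 * frobSq (A - W * A))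
    (C := ![{M | M = Mᵀ ∧ M.PosSemidef ∧ (1 - M).PosSemidef}, Set.univ, {Z | ∀ i j, 0 ≤ Z i j}])
    (G := ![fun _ => 0, fun X => θ * ∑ i, ∑ j, |X i j|, fun _ => 0])
    (x := Ks) (c := ![b1s, b2s, b3s]) (K := K) (Y := fun i => ![M i, X i, Z i])
    (b := fun i => ![b1 i, b2 i, b3 i])
    (by simp [Fin.forall_fin_succ, h1, h2, h3])
    (isClosed_eq continuous_id.matrix_trace continuous_const)
    (by unfold frobSq; fun_prop)
    (by
      simp only [Fin.forall_fin_succ, IsEmpty.forall_iff, and_true]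
      exact ⟨isClosed_setOf_posSemidef_le_one n, isClosed_univ, isClosed_setOf_entrywise_nonneg n⟩)
    (by
      simp only [Fin.forall_fin_succ, IsEmpty.forall_iff, and_true]
      refine ⟨continuous_const, ?_, continuous_const⟩
      change Continuous fun X : Matrix (Fin n) (Fin n) ℝ => θ * ∑ i, ∑ j, |X i j|
      fun_prop)
    (convexOn_half_frobSq_sub_mul A (convex_setOf_trace_eq n J))
    (by
      simp only [Fin.forall_fin_succ, IsEmpty.forall_iff, and_true]
      exact ⟨convexOn_const 0 (convex_setOf_posSemidef_le_one n), convexOn_mul_sum_abs hθ.le,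
        convexOn_const 0 (convex_setOf_entrywise_nonneg n)⟩)
    htr
    (by
      simp only [Fin.forall_fin_succ, IsEmpty.forall_iff, and_true]
      exact ⟨hMs, Set.mem_univ _, hZs⟩)
    (fun W hW => by
      simpa [Fin.sum_univ_three, ← add_assoc] using hsF W hW)
    (by
      simp only [Fin.forall_fin_succ, IsEmpty.forall_iff, and_true]
      exact ⟨fun W hW => by simpa using hsM W hW, fun W _ => by simpa using hsX W,
        fun W hW => by simpa using hsZ W hW⟩)
    hKS
    (fun i W hW => by simpa [Fin.sum_univ_three] using hKr i W hW)
    (fun i => by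
      simp only [Fin.forall_fin_succ, IsEmpty.forall_iff, and_true]
      exact ⟨hMC i, Set.mem_univ _, hZC i⟩)
    (fun i => by
      simp only [Fin.forall_fin_succ, IsEmpty.forall_iff, and_true]
      exact ⟨fun W hW => by simpa using hMr i W hW, fun W _ => by simpa using hXr i W,
        fun W hW => by simpa using hZr i W hW⟩)
    (fun i => by
      simp only [Fin.forall_fin_succ, IsEmpty.forall_iff, and_true]
      exact ⟨hb1 i, hb2 i, hb3 i⟩)
  refine ⟨x, x, x, x, c 0, c 1, c 2, hKx, hYx 0, hYx 1, hYx 2, hbc 0, hbc 1, hbc 2,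
    rfl, rfl, rfl, ?_⟩
  rw [fObj_add_eq_coe hxS (hxC 0) (hxC 2), fObj_add_eq_coe htr hMs hZs, EReal.coe_eq_coe_iff]
  simpa [Fin.sum_univ_three] using hobj
end

section
/- Let B ∈ ℝ^{n×n} and suppose the symmetric matrix ½(B + Bᵀ) has the eigenvalue decomposition ½(B + Bᵀ) = V diag(μ₁,…,μₙ) Vᵀ with V orthogonal. Define M* = V diag(min(max(μ₁, 0), 1),…, min(max(μₙ, 0), 1)) Vᵀ, obtained by clipping each eigenvalue to the interval [0, 1]. Then M* minimizes ‖M − B‖²_F over the set of all symmetric matrices M ∈ ℝ^{n×n} with both M and I − M positive semidefinite (0 ⪯ M ⪯ I). -/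
open Matrix

/-- The clipping of `t` to `[0, 1]` satisfies the variational inequality characterizing
the projection onto `[0, 1]`. -/
lemma sub_clip_mul_clip_sub_nonneg {x t : ℝ} (h0 : 0 ≤ x) (h1 : x ≤ 1) :
    0 ≤ (x - min (max t 0) 1) * (min (max t 0) 1 - t) := by
  rcases le_total t 0 with ht | ht
  · rw [max_eq_right ht, min_eq_left zero_le_one]
    nlinarith
  · rw [max_eq_left ht]
    rcases le_total t 1 with ht' | ht'
    · simp [min_eq_left ht']
    · rw [min_eq_right ht']
      nlinarith

lemma Matrix.PosSemidef.conj_diagonal {m : Type*} [Fintype m] [DecidableEq m]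
    (V : Matrix m m ℝ) {d : m → ℝ} (hd : ∀ k, 0 ≤ d k) :
    (V * diagonal d * Vᵀ).PosSemidef := by
  simpa using (PosSemidef.diagonal (Pi.le_def.2 hd)).mul_mul_conjTranspose_same V

lemma Matrix.PosSemidef.transpose_mul_mul_diag_nonneg {m : Type*} [Fintype m] [DecidableEq m]
    {M : Matrix m m ℝ} (hM : M.PosSemidef) (V : Matrix m m ℝ) (k : m) :
    0 ≤ (Vᵀ * M * V) k k := by
  simpa using (hM.conjTranspose_mul_mul_same V).diag_nonneg (i := k)

lemma Matrix.sum_sq_le_sum_add_sq {m : Type*} [Fintype m] {X Y : Matrix m m ℝ}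
    (h : 0 ≤ trace (X * Yᵀ)) :
    ∑ i, ∑ j, Y i j ^ 2 ≤ ∑ i, ∑ j, (X i j + Y i j) ^ 2 := by
  have hexp : ∑ i, ∑ j, (X i j + Y i j) ^ 2 =
      ∑ i, ∑ j, X i j ^ 2 + 2 * trace (X * Yᵀ) + ∑ i, ∑ j, Y i j ^ 2 := by
    simp only [trace, diag_apply, mul_apply, transpose_apply, Finset.mul_sum,
      ← Finset.sum_add_distrib]
    refine Finset.sum_congr rfl fun i _ => Finset.sum_congr rfl fun j _ => ?_
    ring
  have hX : 0 ≤ ∑ i, ∑ j, X i j ^ 2 := by positivity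
  linarith

/-- Clipping the eigenvalues of the symmetrization `½(B + Bᵀ)` to `[0,1]` gives a
minimizer of `‖M − B‖²_F` over symmetric matrices `M` with `0 ⪯ M ⪯ I`. -/
theorem eigenvalue_clipping_minimizes (n : ℕ) (B : Matrix (Fin n) (Fin n) ℝ)
    (V : Matrix (Fin n) (Fin n) ℝ) (μ : Fin n → ℝ)
    (hV : Vᵀ * V = 1 ∧ V * Vᵀ = 1)
    (hdecomp : (1 / 2 : ℝ) • (B + Bᵀ) = V * Matrix.diagonal μ * Vᵀ)
    (Mstar : Matrix (Fin n) (Fin n) ℝ)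
    (hMstar : Mstar = V * Matrix.diagonal (fun k => min (max (μ k) 0) 1) * Vᵀ) :
    (Mstarᵀ = Mstar ∧ Mstar.PosSemidef ∧ ((1 : Matrix (Fin n) (Fin n) ℝ) - Mstar).PosSemidef) ∧
    ∀ M : Matrix (Fin n) (Fin n) ℝ, Mᵀ = M → M.PosSemidef →
      ((1 : Matrix (Fin n) (Fin n) ℝ) - M).PosSemidef →
      (∑ i, ∑ j, (Mstar i j - B i j) ^ 2) ≤ ∑ i, ∑ j, (M i j - B i j) ^ 2 := by
  obtain ⟨hV₁, hV₂⟩ := hV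
  set c : Fin n → ℝ := fun k => min (max (μ k) 0) 1
  have hsymm : Mstarᵀ = Mstar := by
    simp [hMstar, Matrix.mul_assoc]
  refine ⟨⟨hsymm, ?_, ?_⟩, fun M hM hM₀ hM₁ => ?_⟩
  · rw [hMstar]
    exact PosSemidef.conj_diagonal V fun k => le_min (le_max_right _ _) zero_le_one
  · have h : 1 - Mstar = V * diagonal (fun k => 1 - c k) * Vᵀ := by
      rw [← diagonal_sub, diagonal_one, Matrix.mul_sub, Matrix.sub_mul, Matrix.mul_one, hV₂,
        hMstar]
    rw [h]
    exact PosSemidef.conj_diagonal V fun k => sub_nonneg.2 (min_le_right _ _)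
  · have hclip : Vᵀ * Mstar * V = diagonal c := by
      calc Vᵀ * Mstar * V = (Vᵀ * V) * diagonal c * (Vᵀ * V) := by
            simp only [hMstar, Matrix.mul_assoc]
        _ = diagonal c := by simp [hV₁]
    have hdiff : Mstar - (1 / 2 : ℝ) • (B + Bᵀ) = V * diagonal (fun k => c k - μ k) * Vᵀ := by
      rw [← diagonal_sub, Matrix.mul_sub, Matrix.sub_mul, hdecomp, hMstar]
    have htrace_symm : trace ((M - Mstar) * (Mstar - B)ᵀ) =
        trace ((M - Mstar) * (Mstar - (1 / 2 : ℝ) • (B + Bᵀ))) := by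
      have hB : trace ((M - Mstar) * Bᵀ) = trace ((M - Mstar) * B) := by
        rw [← trace_transpose, transpose_mul, transpose_transpose, transpose_sub, hM, hsymm,
          trace_mul_comm]
      simp only [transpose_sub, hsymm, Matrix.mul_sub (M - Mstar), Matrix.mul_smul,
        Matrix.mul_add, trace_sub, trace_smul, trace_add, hB, smul_eq_mul]
      ring
    have htrace : trace ((M - Mstar) * (Mstar - B)ᵀ) =
        ∑ k, ((Vᵀ * M * V) k k - c k) * (c k - μ k) := by
      rw [htrace_symm, hdiff, ← Matrix.mul_assoc, trace_mul_comm, ← Matrix.mul_assoc,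
        ← Matrix.mul_assoc, Matrix.mul_sub, Matrix.sub_mul, hclip]
      simp [trace, mul_diagonal]
    have hnonneg : 0 ≤ trace ((M - Mstar) * (Mstar - B)ᵀ) := by
      rw [htrace]
      refine Finset.sum_nonneg fun k _ => sub_clip_mul_clip_sub_nonneg
        (hM₀.transpose_mul_mul_diag_nonneg V k) ?_
      have h := hM₁.transpose_mul_mul_diag_nonneg V k
      rw [Matrix.mul_sub, Matrix.sub_mul, Matrix.mul_one, hV₁] at h
      simpa using h
    simpa using sum_sq_le_sum_add_sq hnonneg
end
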